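/- For the map φ, the divisor singularity pattern beginning at x₂ = 1 confines in four steps: if x₂ = 1 + ε, then as ε → 0, after applying φ four times the image tends to points on the hypersurface x₀ = 1. Precisely, writing φ⁴(x₀⁰, x₁⁰, 1+ε, x₃⁰) = (X₀(ε), X₁(ε), X₂(ε), X₃(ε)) as rational functions of ε, one has lim_{ε→0} X₀(ε) = 1 and lim_{ε→0} X₂(ε) = x₀⁰, for generic x₀⁰, x₁⁰, x₃⁰ and generic h. -/

import Mathlib

open Filter Topology

/-- The map φ reduced from the lattice super-KdV equation. -/
noncomputable def phi (h : ℂ) (p : ℂ × ℂ × ℂ × ℂ) : ℂ × ℂ × ℂ × ℂ :=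
  (p.2.2.1, p.2.2.2,
   -p.2.2.1 - p.1 + h * p.2.2.1 / (1 - p.2.2.1),
   -p.2.1 - p.2.2.2 + (2 - p.2.2.1 + h * p.2.2.2) / (1 - p.2.2.1) ^ 2)

noncomputable def stepF (h a b : ℂ) : ℂ := -b - a + h * b / (1 - b)

theorem stepF_eq (h a b : ℂ) (hb : 1 - b ≠ 0) : stepF h a b = -b - a - h + h * (1 - b)⁻¹ := by
  unfold stepF
  field_simp
  ring

noncomputable def auxP (h x e : ℂ) : ℂ := h + (h + 2 + x) * e + e ^ 2
noncomputable def auxQ (h x e : ℂ) : ℂ := e - h - x * e - h * e ^ 2 / auxP h x e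
noncomputable def auxR (h x e : ℂ) : ℂ := -1 + h / auxP h x e - h / auxQ h x e

theorem aux_y2 (h x e : ℂ) (he : e ≠ 0) :
    1 - stepF h x (1 + e) = auxP h x e / e := by
  have : 1 - (1 + e) ≠ 0 := by simpa using he
  unfold stepF auxP
  have h2 : 1 - (1 + e) = -e := by ring
  rw [h2]
  field_simp
  ring

theorem aux_y3 (h x e : ℂ) (he : e ≠ 0) (hP : auxP h x e ≠ 0) :
    1 - stepF h (1 + e) (stepF h x (1 + e)) = auxQ h x e / e := by
  have h2 := aux_y2 h x e he
  have h3 : stepF h x (1 + e) = 1 - auxP h x e / e := by rw [← h2]; ring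
  rw [stepF_eq _ _ _ (by rw [h2]; exact div_ne_zero hP he), h2, h3, inv_div]
  unfold auxQ
  have : auxP h x e / e = h / e + (h + 2 + x) + e := by unfold auxP; field_simp
  rw [this]
  field_simp
  ring

theorem aux_y4 (h x e : ℂ) (he : e ≠ 0) (hP : auxP h x e ≠ 0) (hQ : auxQ h x e ≠ 0) :
    stepF h (stepF h x (1 + e)) (stepF h (1 + e) (stepF h x (1 + e))) = 1 - e * auxR h x e := by
  have h2 := aux_y2 h x e he
  have h3 := aux_y3 h x e he hP
  have h2' : stepF h x (1 + e) = 1 - auxP h x e / e := by rw [← h2]; ring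
  have h3' : stepF h (1 + e) (stepF h x (1 + e)) = 1 - auxQ h x e / e := by rw [← h3]; ring
  rw [stepF_eq _ _ _ (by rw [h3]; exact div_ne_zero hQ he), h3, h3', h2', inv_div]
  have e1 : auxP h x e / e = h / e + (h + 2 + x) + e := by unfold auxP; field_simp
  have e2 : auxQ h x e / e = 1 - h / e - x - h * e / auxP h x e := by
    unfold auxQ; field_simp
  rw [e1, e2]
  unfold auxR
  ring

theorem aux_y5 (h x e : ℂ) (he : e ≠ 0) (hP : auxP h x e ≠ 0) (hQ : auxQ h x e ≠ 0)
    (hR : auxR h x e ≠ 0) :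
    stepF h (stepF h (1 + e) (stepF h x (1 + e)))
      (stepF h (stepF h x (1 + e)) (stepF h (1 + e) (stepF h x (1 + e)))) =
    -(1 - e * auxR h x e) - x - h * e / auxP h x e - h +
      h * ((h + 2 + x + e) / auxP h x e + (1 - x - h * e / auxP h x e) / auxQ h x e)
        / auxR h x e := by
  have h3 := aux_y3 h x e he hP
  have h4 := aux_y4 h x e he hP hQ
  have h3' : stepF h (1 + e) (stepF h x (1 + e)) = 1 - auxQ h x e / e := by rw [← h3]; ring
  have h5 : 1 - (1 - e * auxR h x e) = e * auxR h x e := by ring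
  rw [h4, stepF_eq _ _ _ (by rw [h5]; exact mul_ne_zero he hR), h5, h3']
  have e2 : auxQ h x e / e = 1 - h / e - x - h * e / auxP h x e := by
    unfold auxQ; field_simp
  rw [e2]
  have e3 : (h + 2 + x + e) / auxP h x e = (1 - h / auxP h x e) / e := by
    field_simp
    unfold auxP; ring
  have e4 : (1 - x - h * e / auxP h x e) / auxQ h x e = (1 + h / auxQ h x e) / e := by
    have : (1 - x - h * e / auxP h x e) = (auxQ h x e + h) / e := by
      unfold auxQ; field_simp; ring
    rw [this]
    field_simp
  have e5 : (h + 2 + x + e) / auxP h x e + (1 - x - h * e / auxP h x e) / auxQ h x e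
      = (1 - auxR h x e) / e := by
    rw [e3, e4]; unfold auxR; ring
  rw [e5]
  field_simp
  ring

/-- The singularity pattern starting at the hypersurface x₂ = 1 confines after
four steps: for generic parameters (a dense open set of (h, x₀, x₁, x₃), with h ≠ 0),
the fourth iterate of φ applied to (x₀, x₁, 1+ε, x₃) tends, as ε → 0, to a point
with first coordinate 1 and third coordinate x₀. -/
theorem singularity_confined_in_four_steps :
    ∃ U : Set (ℂ × ℂ × ℂ × ℂ), Dense U ∧ IsOpen U ∧
      ∀ h x0 x1 x3 : ℂ, (h, x0, x1, x3) ∈ U → h ≠ 0 →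
        Tendsto (fun ε : ℂ => ((phi h)^[4] (x0, x1, 1 + ε, x3)).1)
          (𝓝[≠] (0:ℂ)) (𝓝 1) ∧
        Tendsto (fun ε : ℂ => ((phi h)^[4] (x0, x1, 1 + ε, x3)).2.2.1)
          (𝓝[≠] (0:ℂ)) (𝓝 x0) := by 
  refine ⟨Set.univ, dense_univ, isOpen_univ, ?_⟩
  intro h x0 x1 x3 _ hh
  have P0 : auxP h x0 0 = h := by simp [auxP]
  have Q0 : auxQ h x0 0 = -h := by simp [auxQ]
  have R0 : auxR h x0 0 = 1 := by
    simp only [auxR, P0, Q0]; field_simp; ring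
  have cP : ContinuousAt (auxP h x0) 0 := by unfold auxP; fun_prop
  have nP : auxP h x0 0 ≠ 0 := by rw [P0]; exact hh
  have cQ : ContinuousAt (auxQ h x0) 0 := by
    unfold auxQ; fun_prop (disch := assumption)
  have nQ : auxQ h x0 0 ≠ 0 := by rw [Q0]; exact neg_ne_zero.mpr hh
  have cR : ContinuousAt (auxR h x0) 0 := by
    unfold auxR; fun_prop (disch := assumption)
  have nR : auxR h x0 0 ≠ 0 := by rw [R0]; exact one_ne_zero
  have eP := (cP.eventually_ne nP).filter_mono (nhdsWithin_le_nhds (s := {0}ᶜ))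
  have eQ := (cQ.eventually_ne nQ).filter_mono (nhdsWithin_le_nhds (s := {0}ᶜ))
  have eR := (cR.eventually_ne nR).filter_mono (nhdsWithin_le_nhds (s := {0}ᶜ))
  have e0 : ∀ᶠ e : ℂ in 𝓝[≠] 0, e ≠ 0 := eventually_mem_nhdsWithin
  constructor
  · have c : ContinuousAt (fun e => 1 - e * auxR h x0 e) 0 := by fun_prop
    have t := c.tendsto.mono_left (nhdsWithin_le_nhds (s := {0}ᶜ))
    simp only [zero_mul, sub_zero] at t
    refine t.congr' ?_
    filter_upwards [eP, eQ, e0] with e hP hQ he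
    exact (aux_y4 h x0 e he hP hQ).symm
  · have c : ContinuousAt (fun e => -(1 - e * auxR h x0 e) - x0 - h * e / auxP h x0 e - h +
      h * ((h + 2 + x0 + e) / auxP h x0 e + (1 - x0 - h * e / auxP h x0 e) / auxQ h x0 e)
        / auxR h x0 e) 0 := by fun_prop (disch := assumption)
    have t := c.tendsto.mono_left (nhdsWithin_le_nhds (s := {0}ᶜ))
    have v : -(1 - 0 * auxR h x0 0) - x0 - h * 0 / auxP h x0 0 - h +
      h * ((h + 2 + x0 + 0) / auxP h x0 0 + (1 - x0 - h * 0 / auxP h x0 0) / auxQ h x0 0)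
        / auxR h x0 0 = x0 := by
      rw [P0, Q0, R0]; field_simp; ring
    rw [v] at t
    refine t.congr' ?_
    filter_upwards [eP, eQ, eR, e0] with e hP hQ hR he
    exact (aux_y5 h x0 e he hP hQ hR).symm
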